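/- Assume G is connected, n ≥ 3, and (G;C) is twin free. Let u ∈ V and i ∈ {1,…,m}. The inequality x_{u,i} + Σ_{v∈N⟨u⟩} y_{v,i} ≤ 1 is facet-defining for P if and only if i = 1 or for every v ∈ N⟨u⟩ there exists w ∈ N⟨u⟩ ∖ {v} such that v ◁ w. -/

import Mathlib

open Finset

namespace LegalSeq

variable {V : Type*}

/-- The generalized neighborhood `N⟨v⟩`: the closed neighborhood of `v` if `v ∈ C`,
the open neighborhood otherwise. -/
noncomputable def gN [Fintype V] (G : SimpleGraph V) (C : Set V) (v : V) : Finset V := by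
  classical
  exact (Set.toFinite (if v ∈ C then insert v (G.neighborSet v) else G.neighborSet v)).toFinset

/-- The ambient space `ℝ^{V×{1,…,m}} × ℝ^{V×{1,…,m}}` of the polytope of legal sequences. -/
abbrev Pt (V : Type*) (m : ℕ) := (V × Fin m → ℝ) × (V × Fin m → ℝ)

/-- Feasible 0/1 pairs `(x, y)` of the formulation `F₁` (constraints (1)-(5)). -/
def Feasible [Fintype V] (G : SimpleGraph V) (C : Set V) (m : ℕ) : Set (Pt V m) :=
  { p | (∀ q, p.1 q = 0 ∨ p.1 q = 1) ∧ (∀ q, p.2 q = 0 ∨ p.2 q = 1) ∧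
    (∀ i : Fin m, ∑ v : V, p.2 (v, i) ≤ 1) ∧
    (∀ v : V, ∑ i : Fin m, p.2 (v, i) ≤ 1) ∧
    (∀ (v : V) (i : Fin m) (h : i.1 + 1 < m),
        p.2 (v, ⟨i.1 + 1, h⟩) ≤ ∑ u ∈ gN G C v, (p.1 (u, i) - p.1 (u, ⟨i.1 + 1, h⟩))) ∧
    (∀ (u : V) (i : Fin m), p.1 (u, i) + ∑ v ∈ gN G C u, p.2 (v, i) ≤ 1) ∧
    (∀ (u : V) (i : Fin m) (h : i.1 + 1 < m), p.1 (u, ⟨i.1 + 1, h⟩) ≤ p.1 (u, i)) }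

/-- The polytope of legal sequences: the convex hull of the feasible 0/1 pairs. -/
noncomputable def poly [Fintype V] (G : SimpleGraph V) (C : Set V) (m : ℕ) : Set (Pt V m) :=
  convexHull ℝ (Feasible G C m)

/-- `δ(G;C)`, the minimum cardinality of a generalized neighborhood. -/
noncomputable def gdelta [Fintype V] (G : SimpleGraph V) (C : Set V) : ℕ :=
  sInf (Set.range fun v : V => (gN G C v).card)

/-- The instance `(G;C)` is twin free if distinct vertices have distinct
generalized neighborhoods. -/
def TwinFree [Fintype V] (G : SimpleGraph V) (C : Set V) : Prop :=
  ∀ u v : V, u ≠ v → gN G C u ≠ gN G C v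

/-- The inequality `f p ≤ a` is valid for the polytope and the face it defines has affine
dimension `2nm - 1`, i.e. it is facet-defining. -/
def IsFacet [Fintype V] (G : SimpleGraph V) (C : Set V) (m : ℕ)
    (f : Pt V m → ℝ) (a : ℝ) : Prop :=
  (∀ p ∈ poly G C m, f p ≤ a) ∧
  Module.finrank ℝ ((affineSpan ℝ {p ∈ poly G C m | f p = a}).direction) =
    2 * Fintype.card V * m - 1

section Neighborhoods

variable [Fintype V] {G : SimpleGraph V} {C : Set V}

theorem mem_gN {v w : V} : w ∈ gN G C v ↔ G.Adj v w ∨ (w = v ∧ v ∈ C) := by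
  unfold gN
  by_cases h : v ∈ C <;> simp [h, or_comm]

theorem mem_gN_comm {v w : V} : w ∈ gN G C v ↔ v ∈ gN G C w := by
  rw [mem_gN, mem_gN, G.adj_comm]
  constructor <;> rintro (h | ⟨rfl, h⟩) <;> simp [h]

theorem gN_nonempty (hiso : ∀ w : V, w ∉ C → ∃ z, G.Adj w z) (v : V) : (gN G C v).Nonempty := by
  by_cases h : v ∈ C
  · exact ⟨v, mem_gN.2 (Or.inr ⟨rfl, h⟩)⟩
  · obtain ⟨z, hz⟩ := hiso v h
    exact ⟨z, mem_gN.2 (Or.inl hz)⟩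

end Neighborhoods

/-- The `x`-part in which vertex `p` has value `1` exactly at the first `ℓ p` steps. -/
def levelX (m : ℕ) (ℓ : V → ℕ) : V × Fin m → ℝ := fun q => if q.2.1 < ℓ q.1 then 1 else 0

open Classical in
/-- The `y`-part given by the indicator of a finite set of (vertex, step) choices. -/
noncomputable def choiceY {m : ℕ} (T : Finset (V × Fin m)) : V × Fin m → ℝ :=
  fun q => if q ∈ T then 1 else 0

theorem choiceY_nonneg {m : ℕ} (T : Finset (V × Fin m)) (q : V × Fin m) : 0 ≤ choiceY T q := by
  unfold choiceY; split_ifs <;> norm_num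

theorem sum_indicator_le_one {ι : Type*} (s : Finset ι) (P : ι → Prop) [DecidablePred P]
    (h : ∀ a b, P a → P b → a = b) : ∑ a ∈ s, (if P a then (1 : ℝ) else 0) ≤ 1 := by
  rw [Finset.sum_boole]
  have : (s.filter P).card ≤ 1 :=
    Finset.card_le_one.2 fun a ha b hb => h a b (mem_filter.1 ha).2 (mem_filter.1 hb).2
  exact_mod_cast this

theorem level_choice_mem_feasible [Fintype V] {G : SimpleGraph V} {C : Set V} {m : ℕ}
    (ℓ : V → ℕ) (T : Finset (V × Fin m))
    (hstep : ∀ v w j, (v, j) ∈ T → (w, j) ∈ T → v = w)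
    (hvert : ∀ v j k, (v, j) ∈ T → (v, k) ∈ T → j = k)
    (hfoot : ∀ v j, (v, j) ∈ T → 0 < j.1 → ∃ p ∈ gN G C v, ℓ p = j.1)
    (hcov : ∀ v j, (v, j) ∈ T → ∀ p ∈ gN G C v, ℓ p ≤ j.1) :
    (levelX m ℓ, choiceY T) ∈ Feasible G C m := by
  classical
  have hmono : ∀ (u : V) (i : Fin m) (h : i.1 + 1 < m),
      levelX m ℓ (u, ⟨i.1 + 1, h⟩) ≤ levelX m ℓ (u, i) := by
    intro u i h
    simp only [levelX]
    split_ifs <;> first | omega | norm_num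
  have hsum : ∀ (s : Finset V) (i : Fin m), ∑ v ∈ s, choiceY T (v, i) ≤ 1 := fun s i =>
    sum_indicator_le_one _ (fun v => (v, i) ∈ T) fun a b ha hb => hstep a b i ha hb
  refine ⟨?_, ?_, hsum _, ?_, ?_, ?_, hmono⟩
  · intro q; simp only [levelX]; split_ifs <;> simp
  · intro q; simp only [choiceY]; split_ifs <;> simp
  · intro v
    exact sum_indicator_le_one _ (fun i => (v, i) ∈ T) fun a b ha hb => hvert v a b ha hb
  · intro v i h
    have hnn : ∀ p ∈ gN G C v, 0 ≤ levelX m ℓ (p, i) - levelX m ℓ (p, ⟨i.1 + 1, h⟩) :=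
      fun p _ => sub_nonneg.2 (hmono p i h)
    by_cases hT : (v, (⟨i.1 + 1, h⟩ : Fin m)) ∈ T
    · obtain ⟨p, hp, hl⟩ := hfoot _ _ hT (Nat.succ_pos _)
      refine le_trans ?_ (Finset.single_le_sum hnn hp)
      simp [choiceY, levelX, hT, hl]
    · simpa [choiceY, hT] using Finset.sum_nonneg hnn
  · intro u i
    by_cases hex : ∃ v ∈ gN G C u, (v, i) ∈ T
    · obtain ⟨v, hv, hT⟩ := hex
      have hl := hcov v i hT u (mem_gN_comm.1 hv)
      have h0 : levelX m ℓ (u, i) = 0 := by simp [levelX, hl]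
      simpa [h0] using hsum (gN G C u) i
    · push Not at hex
      have h0 : ∑ v ∈ gN G C u, choiceY T (v, i) = 0 :=
        Finset.sum_eq_zero fun v hv => by simp [choiceY, hex v hv]
      simp only [h0, add_zero, levelX]
      split_ifs <;> norm_num

/-- The left-hand side of constraint (4) as a linear functional. -/
noncomputable def coverForm [Fintype V] (G : SimpleGraph V) (C : Set V) {m : ℕ} (u : V)
    (i : Fin m) : Pt V m →ₗ[ℝ] ℝ :=
  LinearMap.proj (u, i) ∘ₗ LinearMap.fst ℝ _ _ +
    ∑ v ∈ gN G C u, LinearMap.proj (v, i) ∘ₗ LinearMap.snd ℝ _ _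

theorem coverForm_apply [Fintype V] (G : SimpleGraph V) (C : Set V) {m : ℕ} (u : V) (i : Fin m)
    (p : Pt V m) : coverForm G C u i p = p.1 (u, i) + ∑ v ∈ gN G C u, p.2 (v, i) := by
  simp [coverForm]

/-- A linear inequality valid on the feasible pairs is valid on the polytope. -/
theorem le_of_mem_poly [Fintype V] {G : SimpleGraph V} {C : Set V} {m : ℕ}
    (f : Pt V m →ₗ[ℝ] ℝ) (a : ℝ) (h : ∀ p ∈ Feasible G C m, f p ≤ a) :
    ∀ p ∈ poly G C m, f p ≤ a := fun _ hp =>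
  convexHull_min (t := {p | f p ≤ a}) h (convex_halfSpace_le f.isLinear a) hp

theorem coverForm_le_one [Fintype V] {G : SimpleGraph V} {C : Set V} {m : ℕ} (u : V) (i : Fin m) :
    ∀ p ∈ poly G C m, coverForm G C u i p ≤ 1 :=
  le_of_mem_poly _ _ fun p hp => by
    rw [coverForm_apply]; exact hp.2.2.2.2.2.1 u i

theorem level_choice_mem_face [Fintype V] {G : SimpleGraph V} {C : Set V} {m : ℕ} (u : V)
    (i : Fin m) (ℓ : V → ℕ) (T : Finset (V × Fin m))
    (hstep : ∀ v w j, (v, j) ∈ T → (w, j) ∈ T → v = w)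
    (hvert : ∀ v j k, (v, j) ∈ T → (v, k) ∈ T → j = k)
    (hfoot : ∀ v j, (v, j) ∈ T → 0 < j.1 → ∃ p ∈ gN G C v, ℓ p = j.1)
    (hcov : ∀ v j, (v, j) ∈ T → ∀ p ∈ gN G C v, ℓ p ≤ j.1)
    (htight : i.1 < ℓ u ∨ ∃ v ∈ gN G C u, (v, i) ∈ T) :
    (levelX m ℓ, choiceY T) ∈ {p ∈ poly G C m | coverForm G C u i p = 1} := by
  have hmem : (levelX m ℓ, choiceY T) ∈ poly G C m :=
    subset_convexHull ℝ _ (level_choice_mem_feasible ℓ T hstep hvert hfoot hcov)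
  refine ⟨hmem, le_antisymm (coverForm_le_one u i _ hmem) ?_⟩
  have hnn : ∀ v ∈ gN G C u, 0 ≤ choiceY T (v, i) := fun v _ => choiceY_nonneg T _
  rw [coverForm_apply]
  rcases htight with h | ⟨v, hv, hT⟩
  · have h1 : levelX m ℓ (u, i) = 1 := by simp [levelX, h]
    have := Finset.sum_nonneg hnn
    simp only [h1]; linarith
  · have h1 := Finset.single_le_sum hnn hv
    have h2 : choiceY T (v, i) = 1 := by simp [choiceY, hT]
    have h3 : 0 ≤ levelX m ℓ (u, i) := by simp only [levelX]; split_ifs <;> norm_num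
    simp only; linarith

/-- A linear functional that is constant on the face of constraint (4) is a multiple of the
left-hand side of the constraint. -/
theorem eq_smul_coverForm [Fintype V] {G : SimpleGraph V} {C : Set V} {m : ℕ}
    (hiso : ∀ w : V, w ∉ C → ∃ z, G.Adj w z) (u : V) (i : Fin m)
    (hcond : i.1 = 0 ∨ ∀ v ∈ gN G C u, ∃ w ∈ gN G C u, w ≠ v ∧ ¬ (gN G C w ⊆ gN G C v))
    (φ : Pt V m →ₗ[ℝ] ℝ) (c : ℝ)
    (hφ : ∀ p ∈ {p ∈ poly G C m | coverForm G C u i p = 1}, φ p = c) :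
    φ = c • coverForm G C u i := by
  classical
  set A : (V → ℕ) → ℝ := fun ℓ => φ (levelX m ℓ, 0) with hA
  set β : V → Fin m → ℝ := fun v j => φ (0, Pi.single (v, j) 1) with hβ
  have hsingle : ∀ (v : V) (j : Fin m), choiceY {(v, j)} = Pi.single (v, j) (1 : ℝ) := by
    intro v j; ext q; simp [choiceY, Pi.single_apply]
  have hnone : ∀ ℓ : V → ℕ, i.1 < ℓ u → A ℓ = c := by
    intro ℓ hℓ
    have h := hφ _ (level_choice_mem_face (G := G) (C := C) u i ℓ ∅ (by simp) (by simp) (by simp)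
      (by simp) (Or.inl hℓ))
    have h0 : choiceY (∅ : Finset (V × Fin m)) = 0 := by ext q; simp [choiceY]
    rwa [h0] at h
  have hone : ∀ (ℓ : V → ℕ) (v : V) (j : Fin m),
      (0 < j.1 → ∃ p ∈ gN G C v, ℓ p = j.1) → (∀ p ∈ gN G C v, ℓ p ≤ j.1) →
      (i.1 < ℓ u ∨ (v ∈ gN G C u ∧ j = i)) → A ℓ + β v j = c := by
    intro ℓ v j hf hc ht
    have h := hφ _ (level_choice_mem_face (G := G) (C := C) u i ℓ {(v, j)}
      (by simp) (by simp; grind) (by simp; grind) (by simp; grind)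
      (ht.imp id fun h => ⟨v, h.1, by simp [h.2]⟩))
    rw [← h, hsingle, hA, hβ, ← map_add]; simp
  have hlast : ∀ (ℓ : V → ℕ), A ℓ = A (Function.update 0 u (ℓ u)) := by
    intro ℓ
    have e : levelX m ℓ = levelX m (Function.update ℓ u (i.1 + 1)) -
        levelX m (Function.update 0 u (i.1 + 1)) + levelX m (Function.update 0 u (ℓ u)) := by
      ext ⟨p, j⟩
      by_cases hp : p = u
      · subst hp; simp [levelX]
      · simp [levelX, hp]
    have h1 := hnone (Function.update ℓ u (i.1 + 1)) (by simp)
    have h2 := hnone (Function.update 0 u (i.1 + 1)) (by simp)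
    have h3 : A ℓ = A (Function.update ℓ u (i.1 + 1)) - A (Function.update 0 u (i.1 + 1)) +
        A (Function.update 0 u (ℓ u)) := by
      rw [hA]; simp only; rw [e, ← map_sub, ← map_add]; simp
    linarith
  have hzero : A 0 = 0 := by
    have : levelX m (0 : V → ℕ) = 0 := by ext q; simp [levelX]
    rw [hA]; simp only [this]; exact map_zero φ
  have hlow : ∀ ℓ : V → ℕ, ℓ u ≤ i.1 → A ℓ = 0 := by
    rcases hcond with h0 | hcond
    · intro ℓ hℓ
      rw [hlast, show ℓ u = 0 by omega]
      simpa using hzero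
    · obtain ⟨v, hv⟩ := gN_nonempty hiso u
      obtain ⟨w, hw, -, hsub⟩ := hcond v hv
      obtain ⟨q, hqw, hqv⟩ := Finset.not_subset.1 hsub
      have hqu : q ≠ u := by rintro rfl; exact hqv (mem_gN_comm.1 hv)
      have key : ∀ k ≤ i.1, A (Function.update 0 u k) + β w i = c := by
        intro k hk
        have h := hone (Function.update (fun _ => i.1) u k) w i
          (fun _ => ⟨q, hqw, by simp [hqu]⟩)
          (fun p _ => by by_cases hp : p = u <;> simp [hp, hk]) (Or.inr ⟨hw, rfl⟩)
        rw [hlast] at h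
        simpa using h
      intro ℓ hℓ
      rw [hlast]
      have h1 := key _ hℓ
      have h2 := key 0 (Nat.zero_le _)
      have h3 : A (Function.update 0 u 0) = 0 := by simpa using hzero
      linarith
  have hβi : ∀ v ∈ gN G C u, β v i = c := by
    intro v hv
    have h := hone (fun _ => i.1) v i (fun _ => ⟨u, mem_gN_comm.1 hv, rfl⟩) (fun _ _ => le_rfl)
      (Or.inr ⟨hv, rfl⟩)
    rw [hlow _ le_rfl] at h
    linarith
  have hβ0 : ∀ v j, ¬ (v ∈ gN G C u ∧ j = i) → β v j = 0 := by
    intro v j hvj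
    by_cases hhi : v ∈ gN G C u → i.1 < j.1
    · have hu : i.1 < (fun p => if p ∈ gN G C v then j.1 else i.1 + 1) u := by
        by_cases hm : u ∈ gN G C v
        · simpa [hm] using hhi (mem_gN_comm.1 hm)
        · simp [hm]
      have h := hone (fun p => if p ∈ gN G C v then j.1 else i.1 + 1) v j
        (fun _ => by
          obtain ⟨p, hp⟩ := gN_nonempty hiso v
          exact ⟨p, hp, by simp [hp]⟩)
        (fun p hp => by simp [hp]) (Or.inl hu)
      rw [hnone _ hu] at h
      linarith
    · push Not at hhi
      obtain ⟨hv, hji⟩ := hhi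
      have hne : j ≠ i := fun h => hvj ⟨hv, h⟩
      have hlt : j.1 < i.1 := lt_of_le_of_ne hji fun h => hne (Fin.ext h)
      obtain ⟨w, hw, hwv, hsub⟩ := hcond.resolve_left (by omega) v hv
      obtain ⟨q, hqw, hqv⟩ := Finset.not_subset.1 hsub
      set ℓ : V → ℕ := fun p => if p ∈ gN G C v then j.1 else i.1 with hℓ
      have h := hφ _ (level_choice_mem_face (G := G) (C := C) u i ℓ {(v, j), (w, i)}
        (by simp; grind) (by simp; grind)
        (by
          intro a b hab _
          simp only [mem_insert, mem_singleton, Prod.mk.injEq] at hab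
          rcases hab with ⟨rfl, rfl⟩ | ⟨rfl, rfl⟩
          · exact ⟨u, mem_gN_comm.1 hv, by simp [hℓ, mem_gN_comm.1 hv]⟩
          · exact ⟨q, hqw, by simp [hℓ, hqv]⟩)
        (by
          intro a b hab p hp
          simp only [mem_insert, mem_singleton, Prod.mk.injEq] at hab
          rcases hab with ⟨rfl, rfl⟩ | ⟨rfl, rfl⟩
          · simp [hℓ, hp]
          · simp only [hℓ]; split_ifs <;> omega)
        (Or.inr ⟨w, hw, by simp⟩))
      have hY : choiceY {(v, j), (w, i)} =
          (Pi.single (v, j) (1 : ℝ) + Pi.single (w, i) 1 : V × Fin m → ℝ) := by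
        ext ⟨a, b⟩
        simp only [choiceY, mem_insert, mem_singleton, Prod.mk.injEq, Pi.add_apply,
          Pi.single_apply]
        by_cases h1 : a = v ∧ b = j
        · have h2 : ¬ (a = w ∧ b = i) := fun h2 => hne (h1.2.symm.trans h2.2)
          simp [h1, hne]
        · simp [h1]
      have hsplit : ((levelX m ℓ, Pi.single (v, j) 1 + Pi.single (w, i) 1) : Pt V m) =
          (levelX m ℓ, 0) + (0, Pi.single (v, j) 1) + (0, Pi.single (w, i) 1) := by simp
      rw [hY, hsplit, map_add, map_add] at h
      have h1 : A ℓ = 0 := hlow ℓ (by simp only [hℓ]; split_ifs <;> omega)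
      have h2 := hβi w hw
      simp only [hA] at h1
      simp only [hβ] at h2 ⊢
      linarith
  have hα : ∀ (p : V) (j : Fin m), φ (Pi.single (p, j) 1, 0) = if p = u ∧ j = i then c else 0 := by
    intro p j
    have e : ((Pi.single (p, j) 1, 0) : Pt V m) =
        (levelX m (Function.update 0 p (j.1 + 1)), 0) - (levelX m (Function.update 0 p j.1), 0) := by
      ext ⟨a, b⟩
      · by_cases ha : a = p
        · subst ha
          simp only [Pi.single_apply, Prod.mk.injEq, levelX, Prod.fst_sub, Pi.sub_apply,
            Function.update_self, true_and, Fin.ext_iff]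
          split_ifs <;> first | omega | norm_num
        · simp [levelX, ha]
      · simp
    rw [e, map_sub]
    change A _ - A _ = _
    by_cases hp : p = u
    · subst hp
      by_cases hj : j = i
      · subst hj
        rw [hnone _ (by simp), hlow _ (by simp)]; simp
      · rcases lt_or_gt_of_ne (fun h => hj (Fin.ext h) : j.1 ≠ i.1) with h | h
        · rw [hlow _ (by simp; omega), hlow _ (by simp; omega)]; simp [hj]
        · rw [hnone _ (by simp; omega), hnone _ (by simpa using h)]; simp [hj]
    · rw [hlow _ (by simp [Ne.symm hp]), hlow _ (by simp [Ne.symm hp])]; simp [hp]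
  refine LinearMap.prod_ext (LinearMap.pi_ext' fun ⟨p, j⟩ => LinearMap.ext_ring ?_)
    (LinearMap.pi_ext' fun ⟨p, j⟩ => LinearMap.ext_ring ?_)
  · simp only [LinearMap.comp_apply, LinearMap.inl_apply, LinearMap.coe_single,
      LinearMap.smul_apply, coverForm_apply, hα]
    simp [Pi.single_apply, eq_comm]
  · simp only [LinearMap.comp_apply, LinearMap.inr_apply, LinearMap.coe_single,
      LinearMap.smul_apply, coverForm_apply]
    change β p j = _
    by_cases hpj : p ∈ gN G C u ∧ j = i
    · obtain ⟨hp, rfl⟩ := hpj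
      simp [hβi p hp, Pi.single_apply, hp]
    · rw [hβ0 p j hpj]
      have : ∀ v ∈ gN G C u, (Pi.single (p, j) (1 : ℝ) : V × Fin m → ℝ) (v, i) = 0 := by
        intro v hv
        simp only [Pi.single_apply, Prod.mk.injEq]
        rw [if_neg]
        rintro ⟨rfl, rfl⟩
        exact hpj ⟨hv, rfl⟩
      simp [Finset.sum_eq_zero this]

/-- If `N⟨w⟩ ⊆ N⟨v⟩` for all `w ∈ N⟨u⟩`, then constraint (4) at a step `i` later than the first
can be strengthened by the summand for choosing `v` at the first step. -/
theorem coverForm_add_le_one [Fintype V] {G : SimpleGraph V} {C : Set V} {m : ℕ} (u v : V)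
    (i z : Fin m) (hz : z.1 = 0) (hi : 0 < i.1) (hv : v ∈ gN G C u)
    (hsub : ∀ w ∈ gN G C u, w ≠ v → gN G C w ⊆ gN G C v)
    (p : Pt V m) (hp : p ∈ Feasible G C m) :
    coverForm G C u i p + p.2 (v, z) ≤ 1 := by
  obtain ⟨hx, hy, -, hvert, hfoot, hcov, hmono⟩ := hp
  have hx0 : ∀ q, 0 ≤ p.1 q := fun q => by rcases hx q with h | h <;> simp [h]
  have hy0 : ∀ q, 0 ≤ p.2 q := fun q => by rcases hy q with h | h <;> simp [h]
  rw [coverForm_apply]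
  rcases hy (v, z) with h | h
  · rw [h, add_zero]; exact hcov u i
  have hcovered : ∀ q ∈ gN G C v, ∀ k : ℕ, ∀ hk : k < m, p.1 (q, ⟨k, hk⟩) = 0 := by
    intro q hq k
    induction k with
    | zero =>
      intro hk
      have h1 := Finset.single_le_sum (f := fun w => p.2 (w, z)) (fun w _ => hy0 (w, z))
        (mem_gN_comm.1 hq)
      have h2 := hcov q z
      have e : (⟨0, hk⟩ : Fin m) = z := Fin.ext hz.symm
      rw [e]
      simp only [h] at h1
      linarith [hx0 (q, z)]
    | succ k ih =>
      intro hk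
      have h1 := hmono q ⟨k, by omega⟩ hk
      rw [ih] at h1
      exact le_antisymm h1 (hx0 _)
  have hxi : p.1 (u, i) = 0 := hcovered u (mem_gN_comm.1 hv) i.1 i.2
  have hyi : ∀ w ∈ gN G C u, p.2 (w, i) = 0 := by
    intro w hw
    by_cases hwv : w = v
    · subst hwv
      have hne : z ≠ i := fun e => by rw [← e] at hi; omega
      have h1 := Finset.add_le_sum (f := fun j => p.2 (w, j)) (s := univ) (fun j _ => hy0 (w, j))
        (mem_univ z) (mem_univ i) hne
      have h2 := hvert w
      simp only [h] at h1
      linarith [hy0 (w, i)]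
    · obtain ⟨k, hk⟩ : ∃ k, i.1 = k + 1 := ⟨i.1 - 1, by omega⟩
      have hkm : k + 1 < m := hk ▸ i.2
      have e : i = ⟨k + 1, hkm⟩ := Fin.ext hk
      have h1 := hfoot w ⟨k, by omega⟩ hkm
      have h2 : ∑ q ∈ gN G C w, (p.1 (q, ⟨k, by omega⟩) - p.1 (q, ⟨k + 1, hkm⟩)) = 0 :=
        Finset.sum_eq_zero fun q hq => by
          rw [hcovered q (hsub w hw hwv hq), hcovered q (hsub w hw hwv hq), sub_zero]
      rw [e]
      exact le_antisymm (h1.trans h2.le) (hy0 _)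
  rw [hxi, Finset.sum_eq_zero hyi, h]; norm_num

theorem finrank_pt [Fintype V] (m : ℕ) :
    Module.finrank ℝ (Pt V m) = 2 * Fintype.card V * m := by
  simp [Module.finrank_prod, Module.finrank_fintype_fun_eq_card]; ring

theorem coverForm_ne_zero [Fintype V] (G : SimpleGraph V) (C : Set V) {m : ℕ} (u : V) (i : Fin m) :
    coverForm G C u i ≠ 0 := by
  classical
  intro h
  have := coverForm_apply G C u i (Pi.single (u, i) 1, 0)
  simp [h] at this

theorem vectorSpan_le_ker {E : Type*} [AddCommGroup E] [Module ℝ E] (f : E →ₗ[ℝ] ℝ) (a : ℝ)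
    (S : Set E) (h : ∀ p ∈ S, f p = a) : vectorSpan ℝ S ≤ LinearMap.ker f := by
  rw [vectorSpan_def, Submodule.span_le]
  rintro _ ⟨p, hp, q, hq, rfl⟩
  simp [h p hp, h q hq]

theorem isFacet_coverForm_iff [Fintype V] {G : SimpleGraph V} {C : Set V} {m : ℕ} (u : V)
    (i : Fin m) :
    IsFacet G C m (fun p => p.1 (u, i) + ∑ v ∈ gN G C u, p.2 (v, i)) 1 ↔
      LinearMap.ker (coverForm G C u i) ≤
        vectorSpan ℝ {p ∈ poly G C m | coverForm G C u i p = 1} := by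
  have hle := vectorSpan_le_ker (coverForm G C u i) 1
    {p ∈ poly G C m | coverForm G C u i p = 1} fun p hp => hp.2
  have hker : Module.finrank ℝ (LinearMap.ker (coverForm G C u i)) =
      2 * Fintype.card V * m - 1 := by
    rw [← finrank_pt]
    exact Nat.eq_sub_of_add_eq
      (Module.Dual.finrank_ker_add_one_of_ne_zero (coverForm_ne_zero G C u i))
  have hfun : (fun p : Pt V m => p.1 (u, i) + ∑ v ∈ gN G C u, p.2 (v, i)) =
      coverForm G C u i := funext fun p => (coverForm_apply G C u i p).symm
  rw [hfun, IsFacet, direction_affineSpan]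
  constructor
  · rintro ⟨-, h⟩
    exact (Submodule.eq_of_le_of_finrank_eq hle (h.trans hker.symm)).ge
  · intro h
    refine ⟨coverForm_le_one u i, ?_⟩
    rw [le_antisymm hle h, hker]

/-- For `G` connected, `n ≥ 3`, `(G;C)` twin free: constraint (4),
`x_{u,i} + Σ_{v∈N⟨u⟩} y_{v,i} ≤ 1`, is facet-defining for `P` iff `i = 1` or every
`v ∈ N⟨u⟩` admits `w ∈ N⟨u⟩ ∖ {v}` with `v ◁ w` (i.e. `N⟨w⟩ ⊄ N⟨v⟩`). -/
theorem constr4_facet_iff [Fintype V] (G : SimpleGraph V) (C : Set V)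
    (hconn : G.Connected) (hcard : 3 ≤ Fintype.card V)
    (hiso : ∀ w : V, w ∉ C → ∃ z, G.Adj w z)
    (htf : TwinFree G C)
    (m : ℕ) (hm : m = Fintype.card V - gdelta G C + 1)
    (u : V) (i : Fin m) :
    IsFacet G C m (fun p => p.1 (u, i) + ∑ v ∈ gN G C u, p.2 (v, i)) 1 ↔
      (i.1 = 0 ∨
        ∀ v ∈ gN G C u, ∃ w ∈ gN G C u, w ≠ v ∧ ¬ (gN G C w ⊆ gN G C v)) := by
  classical
  rw [isFacet_coverForm_iff]
  constructor
  · intro hspan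
    by_contra! hcon
    obtain ⟨hi, v, hv, hsub⟩ := hcon
    set z : Fin m := ⟨0, by omega⟩
    have hzi : z ≠ i := fun e => hi (by rw [← e])
    set g : Pt V m →ₗ[ℝ] ℝ := LinearMap.proj (v, z) ∘ₗ LinearMap.snd ℝ _ _ with hg
    have hgz : ∀ p ∈ {p ∈ poly G C m | coverForm G C u i p = 1}, g p = 0 := by
      rintro p ⟨hp, hp1⟩
      have h1 := le_of_mem_poly (coverForm G C u i + g) 1
        (coverForm_add_le_one u v i z rfl (by omega) hv hsub) p hp
      have h2 := le_of_mem_poly (-g) 0 (fun p hp => by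
        rcases hp.2.1 (v, z) with h | h <;> simp [hg, h]) p hp
      simp only [LinearMap.add_apply, LinearMap.neg_apply] at h1 h2
      linarith
    have hmem : ((0, Pi.single (v, z) 1) : Pt V m) ∈ LinearMap.ker (coverForm G C u i) := by
      rw [LinearMap.mem_ker, coverForm_apply]
      simp [hzi.symm]
    have := vectorSpan_le_ker g 0 _ hgz (hspan hmem)
    simp [hg] at this
  · intro hcond p hp
    by_contra hnot
    obtain ⟨φ, hφp, hφ⟩ := Submodule.exists_le_ker_of_notMem hnot
    obtain ⟨p₀, hp₀⟩ : ∃ p₀, p₀ ∈ {p ∈ poly G C m | coverForm G C u i p = 1} :=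
      ⟨_, level_choice_mem_face u i (fun _ => i.1 + 1) ∅ (by simp) (by simp) (by simp) (by simp)
        (Or.inl (Nat.lt_succ_self _))⟩
    have hconst : ∀ q ∈ {p ∈ poly G C m | coverForm G C u i p = 1}, φ q = φ p₀ := by
      intro q hq
      have := hφ (vsub_mem_vectorSpan ℝ hq hp₀)
      rw [LinearMap.mem_ker, vsub_eq_sub, map_sub] at this
      linarith
    rw [eq_smul_coverForm hiso u i hcond φ _ hconst] at hφp
    rw [LinearMap.mem_ker] at hp
    simp [hp] at hφp

end LegalSeq
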